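/- arXiv:2602.17862 — 2 statements merged into one kernel-verified Lean document; each statement's English description precedes it below -/
import Mathlib

section
/- Let ρₙ be a density matrix on ℂ^d, let Π⊥ be the orthogonal projection onto the orthogonal complement of the range of ρₙ, and let Δ be a Hermitian traceless d×d complex matrix such that for some ϑmax > 0 and every ϑ ∈ (0, ϑmax], the matrix ρₙ + ϑΔ is positive semidefinite. Fix q ∈ (0,1). Then there exist constants C > 0 and ϑ₁ ∈ (0, ϑmax] such that for all ϑ ∈ (0, ϑ₁], |D_q(ρₙ ‖ ρₙ + ϑΔ) − ϑ · Tr(Π⊥ Δ Π⊥)| ≤ C ϑ². -/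
open Matrix
open scoped ComplexOrder

/-- Functional calculus for a Hermitian matrix with the convention `f(0) := 0`,
so that `f(A) := Σⱼ f(λⱼ) Pⱼ` acts only on the support of `A`.  (Junk value `0`
if the matrix is not Hermitian.) -/
noncomputable def matFun {d : ℕ} (A : Matrix (Fin d) (Fin d) ℂ) (f : ℝ → ℝ) :
    Matrix (Fin d) (Fin d) ℂ :=
  if hA : A.IsHermitian then
    (hA.eigenvectorUnitary : Matrix (Fin d) (Fin d) ℂ) *
      Matrix.diagonal (fun i => if hA.eigenvalues i = 0 then 0 else (f (hA.eigenvalues i) : ℂ)) *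
      star (hA.eigenvectorUnitary : Matrix (Fin d) (Fin d) ℂ)
  else 0

/-- Matrix power `A^q := Σⱼ λⱼ^q Pⱼ` with the convention `0^q := 0`. -/
noncomputable def matRpow {d : ℕ} (A : Matrix (Fin d) (Fin d) ℂ) (q : ℝ) :
    Matrix (Fin d) (Fin d) ℂ :=
  matFun A (fun x => x ^ q)

/-- Quantum Tsallis relative entropy `D_q(ρ‖σ) := (1 − Tr(ρ^q σ^{1−q}))/(1 − q)`. -/
noncomputable def tsallisRelEntropy {d : ℕ} (q : ℝ) (ρ σ : Matrix (Fin d) (Fin d) ℂ) : ℝ :=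
  (1 - (Matrix.trace (matRpow ρ q * matRpow σ (1 - q))).re) / (1 - q)

/-- Weighted arithmetic–geometric mean inequality together with a quadratic reverse bound. -/
lemma weighted_amgm_gap {q x y : ℝ} (hq : q ∈ Set.Ioo (0 : ℝ) 1) (hx : 0 < x) (hy : 0 ≤ y) :
    0 ≤ x + (1 - q) * (y - x) - x ^ q * y ^ (1 - q) ∧
      x + (1 - q) * (y - x) - x ^ q * y ^ (1 - q) ≤ q * ((x - y) ^ 2 / x) := by
  obtain ⟨hq0, hq1⟩ := hq
  have hs : 0 < 1 - q := sub_pos.2 hq1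
  have amgm := Real.geom_mean_le_arith_mean2_weighted hq0.le hs.le hx.le hy (by ring)
  refine ⟨by linarith, ?_⟩
  rcases hy.eq_or_lt with rfl | hy
  · rw [Real.zero_rpow hs.ne']
    field_simp
    nlinarith
  have amgm' := Real.geom_mean_le_arith_mean2_weighted hs.le hq0.le hx.le hy.le (by ring)
  have hprod : (x ^ q * y ^ (1 - q)) * (x ^ (1 - q) * y ^ q) = x * y := by
    calc _ = (x ^ q * x ^ (1 - q)) * (y ^ (1 - q) * y ^ q) := by ring
      _ = x * y := by
        rw [← Real.rpow_add hx, ← Real.rpow_add hy]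
        norm_num
  have hG : 0 < x ^ q * y ^ (1 - q) := by positivity
  set G := x ^ q * y ^ (1 - q)
  have hm : 0 < (1 - q) * x + q * y := by positivity
  have hGm : x * y ≤ G * ((1 - q) * x + q * y) := by
    rw [← hprod]
    gcongr
  have key : y * (x - q * (y - x)) ≤ G * x := by
    refine le_of_mul_le_mul_right ?_ hm
    nlinarith [mul_le_mul_of_nonneg_left hGm hx.le, mul_nonneg hy.le (sq_nonneg (q * (y - x)))]
  rw [← mul_div_assoc, le_div_iff₀ hx]
  nlinarith

section

variable {d : ℕ}

/-- The trace of a product of two conjugated diagonal matrices, through the squared overlaps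
of the two bases. -/
lemma trace_conj_diagonal_mul_conj_diagonal (U V : Matrix (Fin d) (Fin d) ℂ) (a b : Fin d → ℝ) :
    (trace ((U * diagonal (fun i => (a i : ℂ)) * star U) *
      (V * diagonal (fun i => (b i : ℂ)) * star V))).re =
      ∑ i, ∑ j, a i * b j * Complex.normSq ((star U * V) i j) := by
  have h : trace ((U * diagonal (fun i => (a i : ℂ)) * star U) *
      (V * diagonal (fun i => (b i : ℂ)) * star V)) =
      trace (diagonal (fun i => (a i : ℂ)) * ((star U * V) * diagonal (fun i => (b i : ℂ)) *
        star (star U * V))) := by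
    rw [star_mul, star_star, mul_assoc U, mul_assoc U, trace_mul_comm U]
    simp only [mul_assoc]
  rw [h]
  set W := star U * V
  rw [trace, Complex.re_sum]
  refine Finset.sum_congr rfl fun i _ => ?_
  rw [diag_apply, diagonal_mul, mul_apply, Complex.re_ofReal_mul, Complex.re_sum, Finset.mul_sum]
  refine Finset.sum_congr rfl fun j _ => ?_
  rw [mul_diagonal, star_apply, Complex.normSq_apply]
  simp
  ring

lemma re_mul_star_apply_self (X : Matrix (Fin d) (Fin d) ℂ) (i : Fin d) :
    ((X * star X) i i).re = ∑ j, Complex.normSq (X i j) := by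
  rw [mul_apply, Complex.re_sum]
  refine Finset.sum_congr rfl fun j _ => ?_
  rw [star_apply, Complex.normSq_apply]
  simp

lemma re_mul_diagonal_mul_star_apply_self (X : Matrix (Fin d) (Fin d) ℂ) (b : Fin d → ℝ)
    (i : Fin d) :
    ((X * diagonal (fun i => (b i : ℂ)) * star X) i i).re =
      ∑ j, b j * Complex.normSq (X i j) := by
  rw [mul_apply, Complex.re_sum]
  refine Finset.sum_congr rfl fun j _ => ?_
  rw [mul_diagonal, star_apply, Complex.normSq_apply]
  simp
  ring

lemma matRpow_eq {A : Matrix (Fin d) (Fin d) ℂ} (hA : A.IsHermitian) {r : ℝ} (hr : r ≠ 0) :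
    matRpow A r = (hA.eigenvectorUnitary : Matrix (Fin d) (Fin d) ℂ) *
      diagonal (fun i => ((hA.eigenvalues i ^ r : ℝ) : ℂ)) *
      star (hA.eigenvectorUnitary : Matrix (Fin d) (Fin d) ℂ) := by
  rw [matRpow, matFun, dif_pos hA]
  congr 3
  ext i
  split_ifs with h
  · simp [h, Real.zero_rpow hr]
  · rfl

lemma eq_conj_diagonal_eigenvalues {A : Matrix (Fin d) (Fin d) ℂ} (hA : A.IsHermitian) :
    A = (hA.eigenvectorUnitary : Matrix (Fin d) (Fin d) ℂ) *
      diagonal (fun i => (hA.eigenvalues i : ℂ)) *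
      star (hA.eigenvectorUnitary : Matrix (Fin d) (Fin d) ℂ) := by
  conv_lhs => rw [hA.spectral_theorem]
  rfl

/-- The projection onto the kernel of a Hermitian matrix is diagonal in its eigenbasis. -/
lemma kernel_projection_mul_eigenvectorUnitary {A P : Matrix (Fin d) (Fin d) ℂ}
    (hA : A.IsHermitian) (hP : P.IsHermitian) (hPP : P * P = P)
    (hker : ∀ x : Fin d → ℂ, P *ᵥ x = x ↔ A *ᵥ x = 0) :
    P * (hA.eigenvectorUnitary : Matrix (Fin d) (Fin d) ℂ) =
      (hA.eigenvectorUnitary : Matrix (Fin d) (Fin d) ℂ) *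
        diagonal (fun i => if hA.eigenvalues i = 0 then 1 else 0) := by
  have hAP : A * P = 0 := by
    apply Matrix.ext_of_mulVec_single
    intro i
    rw [← mulVec_mulVec, (hker _).1 (by rw [mulVec_mulVec, hPP]), zero_mulVec]
  have hPA : P * A = 0 := by
    have := congrArg conjTranspose hAP
    rwa [conjTranspose_mul, hA.eq, hP.eq, conjTranspose_zero] at this
  have hAv := hA.mulVec_eigenvectorBasis
  have hcol : ∀ j, P *ᵥ (hA.eigenvectorBasis j).ofLp =
      (if hA.eigenvalues j = 0 then (1 : ℂ) else 0) • (hA.eigenvectorBasis j).ofLp := by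
    intro j
    split_ifs with h
    · rw [one_smul, hker, hAv, h, zero_smul]
    · have h0 : P *ᵥ (A *ᵥ (hA.eigenvectorBasis j).ofLp) = 0 := by
        rw [mulVec_mulVec, hPA, zero_mulVec]
      rw [hAv, mulVec_smul] at h0
      rw [zero_smul]
      exact (smul_eq_zero.1 h0).resolve_left h
  ext i j
  have := congrFun (hcol j) i
  rw [mul_diagonal, mul_comm]
  simpa [mul_apply, mulVec, dotProduct, IsHermitian.eigenvectorUnitary_apply] using this

lemma sum_normSq_eigenbasis_overlap {A B : Matrix (Fin d) (Fin d) ℂ} (hA : A.IsHermitian)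
    (hB : B.IsHermitian) (i : Fin d) :
    ∑ j, Complex.normSq ((star (hA.eigenvectorUnitary : Matrix (Fin d) (Fin d) ℂ) *
      (hB.eigenvectorUnitary : Matrix (Fin d) (Fin d) ℂ)) i j) = 1 := by
  have hUU : star (hA.eigenvectorUnitary : Matrix (Fin d) (Fin d) ℂ) *
      (hA.eigenvectorUnitary : Matrix (Fin d) (Fin d) ℂ) = 1 := Unitary.coe_star_mul_self _
  have hVV : (hB.eigenvectorUnitary : Matrix (Fin d) (Fin d) ℂ) *
      star (hB.eigenvectorUnitary : Matrix (Fin d) (Fin d) ℂ) = 1 := Unitary.coe_mul_star_self _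
  rw [← re_mul_star_apply_self, star_mul, star_star, mul_assoc,
    ← mul_assoc (hB.eigenvectorUnitary : Matrix (Fin d) (Fin d) ℂ), hVV, one_mul, hUU,
    one_apply_eq, Complex.one_re]

lemma sum_eigenvalues_mul_normSq_eigenbasis_overlap {A B : Matrix (Fin d) (Fin d) ℂ}
    (hA : A.IsHermitian) (hB : B.IsHermitian) (i : Fin d) :
    ∑ j, hB.eigenvalues j *
      Complex.normSq ((star (hA.eigenvectorUnitary : Matrix (Fin d) (Fin d) ℂ) *
        (hB.eigenvectorUnitary : Matrix (Fin d) (Fin d) ℂ)) i j) =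
      ((star (hA.eigenvectorUnitary : Matrix (Fin d) (Fin d) ℂ) * B *
        (hA.eigenvectorUnitary : Matrix (Fin d) (Fin d) ℂ)) i i).re := by
  rw [← re_mul_diagonal_mul_star_apply_self, star_mul, star_star]
  conv_rhs => rw [eq_conj_diagonal_eigenvalues hB]
  simp only [mul_assoc]

lemma eigenvalues_eq_re_conj_apply_self {A : Matrix (Fin d) (Fin d) ℂ} (hA : A.IsHermitian)
    (i : Fin d) :
    hA.eigenvalues i = ((star (hA.eigenvectorUnitary : Matrix (Fin d) (Fin d) ℂ) * A *
      (hA.eigenvectorUnitary : Matrix (Fin d) (Fin d) ℂ)) i i).re := by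
  rw [← sum_eigenvalues_mul_normSq_eigenbasis_overlap hA hA, Unitary.coe_star_mul_self,
    Finset.sum_eq_single i]
  · simp
  · intro j _ hj
    simp [one_apply_ne hj.symm]
  · simp

/-- Eigenvectors of `A` and `B` for distant eigenvalues have an overlap controlled by `B - A`. -/
lemma sum_sq_eigenvalues_sub_mul_normSq_eigenbasis_overlap {A B : Matrix (Fin d) (Fin d) ℂ}
    (hA : A.IsHermitian) (hB : B.IsHermitian) (i : Fin d) :
    ∑ j, (hA.eigenvalues i - hB.eigenvalues j) ^ 2 *
      Complex.normSq ((star (hA.eigenvectorUnitary : Matrix (Fin d) (Fin d) ℂ) *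
        (hB.eigenvectorUnitary : Matrix (Fin d) (Fin d) ℂ)) i j) =
      ((star (hA.eigenvectorUnitary : Matrix (Fin d) (Fin d) ℂ) * ((A - B) * (A - B)) *
        (hA.eigenvectorUnitary : Matrix (Fin d) (Fin d) ℂ)) i i).re := by
  set U := (hA.eigenvectorUnitary : Matrix (Fin d) (Fin d) ℂ) with hU
  set V := (hB.eigenvectorUnitary : Matrix (Fin d) (Fin d) ℂ) with hV
  have hUU : star U * U = 1 := Unitary.coe_star_mul_self _
  have hVV : star V * V = 1 := Unitary.coe_star_mul_self _
  have hVV' : V * star V = 1 := Unitary.coe_mul_star_self _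
  have hUA : star U * A = diagonal (fun i => (hA.eigenvalues i : ℂ)) * star U := by
    conv_lhs => rw [eq_conj_diagonal_eigenvalues hA, ← hU, mul_assoc U, ← mul_assoc, hUU, one_mul]
  have hBV : B * V = V * diagonal (fun i => (hB.eigenvalues i : ℂ)) := by
    conv_lhs => rw [eq_conj_diagonal_eigenvalues hB, ← hV, mul_assoc, hVV, mul_one]
  have hX : star U * (A - B) * V = diagonal (fun i => (hA.eigenvalues i : ℂ)) * (star U * V) -
      (star U * V) * diagonal (fun i => (hB.eigenvalues i : ℂ)) := by
    rw [mul_sub, sub_mul, hUA, mul_assoc _ B, hBV, mul_assoc, mul_assoc]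
  have hXX : star U * ((A - B) * (A - B)) * U =
      (star U * (A - B) * V) * star (star U * (A - B) * V) := by
    have hsub : star (A - B) = A - B := (hA.sub hB).eq
    rw [star_mul, star_mul, star_star, hsub, ← mul_assoc (_ * V), mul_assoc _ V, hVV', mul_one]
    simp only [mul_assoc]
  rw [hXX, re_mul_star_apply_self]
  refine Finset.sum_congr rfl fun j _ => ?_
  rw [hX, Matrix.sub_apply, diagonal_mul, mul_diagonal, mul_comm _ (hB.eigenvalues j : ℂ), ← sub_mul,
    Complex.normSq_mul, ← Complex.ofReal_sub, Complex.normSq_ofReal, sq]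

/-- Quadratic two-sided control of one eigenvalue's share of `1 - Tr (A ^ q * B ^ (1 - q))`. -/
lemma abs_eigenvalue_share_sub_le {A B : Matrix (Fin d) (Fin d) ℂ} (hA : A.PosSemidef)
    (hB : B.PosSemidef) {q : ℝ} (hq : q ∈ Set.Ioo (0 : ℝ) 1) (i : Fin d) :
    |hA.1.eigenvalues i - (∑ j, hA.1.eigenvalues i ^ q * hB.1.eigenvalues j ^ (1 - q) *
        Complex.normSq ((star (hA.1.eigenvectorUnitary : Matrix (Fin d) (Fin d) ℂ) *
          (hB.1.eigenvectorUnitary : Matrix (Fin d) (Fin d) ℂ)) i j)) +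
      (1 - q) * if hA.1.eigenvalues i = 0 then 0 else
        ((star (hA.1.eigenvectorUnitary : Matrix (Fin d) (Fin d) ℂ) * (B - A) *
          (hA.1.eigenvectorUnitary : Matrix (Fin d) (Fin d) ℂ)) i i).re| ≤
      q * (((star (hA.1.eigenvectorUnitary : Matrix (Fin d) (Fin d) ℂ) * ((A - B) * (A - B)) *
        (hA.1.eigenvectorUnitary : Matrix (Fin d) (Fin d) ℂ)) i i).re / hA.1.eigenvalues i) := by
  have h0 := sum_normSq_eigenbasis_overlap hA.1 hB.1 i
  have h1 := sum_eigenvalues_mul_normSq_eigenbasis_overlap hA.1 hB.1 i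
  have h2 := sum_sq_eigenvalues_sub_mul_normSq_eigenbasis_overlap hA.1 hB.1 i
  have h3 := eigenvalues_eq_re_conj_apply_self hA.1 i
  rcases (hA.eigenvalues_nonneg i).eq_or_lt with h | h
  · simp [← h, Real.zero_rpow hq.1.ne']
  have h4 : ((star (hA.1.eigenvectorUnitary : Matrix (Fin d) (Fin d) ℂ) * (B - A) *
      (hA.1.eigenvectorUnitary : Matrix (Fin d) (Fin d) ℂ)) i i).re =
      ∑ j, hB.1.eigenvalues j *
        Complex.normSq ((star (hA.1.eigenvectorUnitary : Matrix (Fin d) (Fin d) ℂ) *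
          (hB.1.eigenvectorUnitary : Matrix (Fin d) (Fin d) ℂ)) i j) - hA.1.eigenvalues i := by
    rw [h1, h3, mul_sub, sub_mul, Matrix.sub_apply, Complex.sub_re]
  rw [if_neg h.ne', ← h2, h4]
  set c := fun j => Complex.normSq
    ((star (hA.1.eigenvectorUnitary : Matrix (Fin d) (Fin d) ℂ) *
      (hB.1.eigenvectorUnitary : Matrix (Fin d) (Fin d) ℂ)) i j)
  set x := hA.1.eigenvalues i
  set y := hB.1.eigenvalues
  change ∑ j, c j = 1 at h0
  change |x - (∑ j, x ^ q * y j ^ (1 - q) * c j) + (1 - q) * (∑ j, y j * c j - x)| ≤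
    q * ((∑ j, (x - y j) ^ 2 * c j) / x)
  have hc0 : ∀ j, 0 ≤ c j := fun j => Complex.normSq_nonneg _
  have heq : x - ∑ j, x ^ q * y j ^ (1 - q) * c j + (1 - q) * (∑ j, y j * c j - x) =
      ∑ j, (x + (1 - q) * (y j - x) - x ^ q * y j ^ (1 - q)) * c j := by
    have hsplit : ∑ j, (x + (1 - q) * (y j - x) - x ^ q * y j ^ (1 - q)) * c j =
        ∑ j, (q * (x * c j) - x ^ q * y j ^ (1 - q) * c j + (1 - q) * (y j * c j)) :=
      Finset.sum_congr rfl fun j _ => by ring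
    rw [hsplit, Finset.sum_add_distrib, Finset.sum_sub_distrib, ← Finset.mul_sum, ← Finset.mul_sum,
      ← Finset.mul_sum, h0]
    ring
  rw [heq, abs_of_nonneg (Finset.sum_nonneg fun j _ => mul_nonneg
    (weighted_amgm_gap hq h (hB.eigenvalues_nonneg j)).1 (hc0 j)), Finset.sum_div, Finset.mul_sum]
  refine Finset.sum_le_sum fun j _ => ?_
  calc _ ≤ q * ((x - y j) ^ 2 / x) * c j := mul_le_mul_of_nonneg_right
        (weighted_amgm_gap hq h (hB.eigenvalues_nonneg j)).2 (hc0 j)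
    _ = _ := by ring

lemma trace_kernel_projection_conj_re {A P : Matrix (Fin d) (Fin d) ℂ}
    (hA : A.IsHermitian) (hP : P.IsHermitian) (hPP : P * P = P)
    (hker : ∀ x : Fin d → ℂ, P *ᵥ x = x ↔ A *ᵥ x = 0) (D : Matrix (Fin d) (Fin d) ℂ) :
    (trace (P * D * P)).re = ∑ i, if hA.eigenvalues i = 0 then
      ((star (hA.eigenvectorUnitary : Matrix (Fin d) (Fin d) ℂ) * D *
        (hA.eigenvectorUnitary : Matrix (Fin d) (Fin d) ℂ)) i i).re else 0 := by
  have hPU := kernel_projection_mul_eigenvectorUnitary hA hP hPP hker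
  have hUU : (hA.eigenvectorUnitary : Matrix (Fin d) (Fin d) ℂ) *
      star (hA.eigenvectorUnitary : Matrix (Fin d) (Fin d) ℂ) = 1 := Unitary.coe_mul_star_self _
  set U := (hA.eigenvectorUnitary : Matrix (Fin d) (Fin d) ℂ)
  have h : trace (P * D * P) = trace (star U * D * U *
      diagonal (fun i => if hA.eigenvalues i = 0 then 1 else 0)) := by
    rw [trace_mul_comm, ← mul_assoc, hPP, mul_assoc _ U, ← hPU, mul_assoc, trace_mul_comm (star U),
      mul_assoc, mul_assoc, hUU, mul_one, trace_mul_comm]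
  rw [h, trace, Complex.re_sum]
  refine Finset.sum_congr rfl fun i _ => ?_
  rw [diag_apply, mul_diagonal]
  split_ifs <;> simp

end

/-- Second-order expansion of the quantum Tsallis relative entropy for a support-extending
perturbation: `D_q(ρₙ‖ρₙ + ϑΔ) = ϑ Tr(Π⊥ Δ Π⊥) + O(ϑ²)`. -/
theorem tsallisRelEntropy_support_extending {d : ℕ}
    (ρn Pperp Δ : Matrix (Fin d) (Fin d) ℂ)
    (hρ : ρn.PosSemidef) (hρtr : ρn.trace = 1)
    (hPherm : Pperp.IsHermitian) (hPidem : Pperp * Pperp = Pperp)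
    (hPker : ∀ x : Fin d → ℂ, Pperp *ᵥ x = x ↔ ρn *ᵥ x = 0)
    (hΔherm : Δ.IsHermitian) (hΔtr : Δ.trace = 0)
    (ϑmax : ℝ) (hϑmax : 0 < ϑmax)
    (hpsd : ∀ ϑ ∈ Set.Ioc (0 : ℝ) ϑmax, (ρn + ϑ • Δ).PosSemidef)
    (q : ℝ) (hq : q ∈ Set.Ioo (0 : ℝ) 1) :
    ∃ C > (0 : ℝ), ∃ ϑ₁ ∈ Set.Ioc (0 : ℝ) ϑmax, ∀ ϑ ∈ Set.Ioc (0 : ℝ) ϑ₁,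
      |tsallisRelEntropy q ρn (ρn + ϑ • Δ)
        - ϑ * (Matrix.trace (Pperp * Δ * Pperp)).re| ≤ C * ϑ ^ 2 := by
  have hU1 : (hρ.1.eigenvectorUnitary : Matrix (Fin d) (Fin d) ℂ) *
    star (hρ.1.eigenvectorUnitary : Matrix (Fin d) (Fin d) ℂ) = 1 := Unitary.coe_mul_star_self _
  have hsum : ∑ i, hρ.1.eigenvalues i = 1 := by
    have := hρ.1.trace_eq_sum_eigenvalues
    rw [hρtr] at this
    simpa using (congrArg Complex.re this).symm
  set U := (hρ.1.eigenvectorUnitary : Matrix (Fin d) (Fin d) ℂ) with hU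
  have hq1 : 0 < 1 - q := sub_pos.2 hq.2
  have hY : ∑ i, ((star U * Δ * U) i i).re = 0 := by
    rw [← Complex.re_sum]
    change (trace (star U * Δ * U)).re = 0
    rw [mul_assoc, trace_mul_comm, mul_assoc, hU1, mul_one, hΔtr, Complex.zero_re]
  set K := ∑ i, q * (((star U * (Δ * Δ) * U) i i).re / hρ.1.eigenvalues i) with hK
  refine ⟨|K| / (1 - q) + 1, by positivity, ϑmax, ⟨hϑmax, le_rfl⟩, fun ϑ hϑ => ?_⟩
  have hσ := hpsd ϑ hϑ
  have hT : (trace (matRpow ρn q * matRpow (ρn + ϑ • Δ) (1 - q))).re =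
      ∑ i, ∑ j, hρ.1.eigenvalues i ^ q * hσ.1.eigenvalues j ^ (1 - q) *
        Complex.normSq ((star U * (hσ.1.eigenvectorUnitary : Matrix (Fin d) (Fin d) ℂ)) i j) := by
    rw [matRpow_eq hρ.1 hq.1.ne', matRpow_eq hσ.1 hq1.ne', trace_conj_diagonal_mul_conj_diagonal]
  have hb := fun i => abs_eigenvalue_share_sub_le hρ hσ hq i
  have hAB : ρn - (ρn + ϑ • Δ) = -(ϑ • Δ) := by abel
  simp only [hAB, add_sub_cancel_left, neg_mul_neg, ← hU, mul_smul_comm, smul_mul_assoc,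
    Matrix.smul_apply,    Complex.smul_re, smul_eq_mul] at hb
  have hbound := (Finset.abs_sum_le_sum_abs _ _).trans (Finset.sum_le_sum fun i (_ : i ∈ Finset.univ) => hb i)
  have hkernel : ∑ i, (if hρ.1.eigenvalues i = 0 then 0 else ϑ * ((star U * Δ * U) i i).re) =
      -(ϑ * (trace (Pperp * Δ * Pperp)).re) := by
    rw [trace_kernel_projection_conj_re hρ.1 hPherm hPidem hPker, eq_neg_iff_add_eq_zero,
      Finset.mul_sum, ← Finset.sum_add_distrib]
    have hϑY : ∑ i, ϑ * ((star U * Δ * U) i i).re = 0 := by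
      rw [← Finset.mul_sum, hY, mul_zero]
    refine (Finset.sum_congr rfl fun i _ => ?_).trans hϑY
    split_ifs <;> simp [hU]
  rw [Finset.sum_add_distrib, Finset.sum_sub_distrib, hsum, ← hT, ← Finset.mul_sum,
    hkernel] at hbound
  have hRHS : ∑ i, q * (ϑ * (ϑ * ((star U * (Δ * Δ) * U) i i).re) / hρ.1.eigenvalues i) =
      K * ϑ ^ 2 := by
    rw [hK, Finset.sum_mul]
    exact Finset.sum_congr rfl fun i _ => by ring
  rw [hRHS] at hbound
  rw [tsallisRelEntropy]
  set T := (trace (matRpow ρn q * matRpow (ρn + ϑ • Δ) (1 - q))).re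
  set τ := (trace (Pperp * Δ * Pperp)).re
  have hdiv : (1 - T) / (1 - q) - ϑ * τ = (1 - T + (1 - q) * -(ϑ * τ)) / (1 - q) := by
    field_simp
    ring
  rw [hdiv, abs_div, abs_of_pos hq1]
  calc _ ≤ K * ϑ ^ 2 / (1 - q) := by gcongr
    _ ≤ |K| * ϑ ^ 2 / (1 - q) := by gcongr; exact le_abs_self K
    _ ≤ (|K| / (1 - q) + 1) * ϑ ^ 2 := by
      rw [add_mul, div_mul_eq_mul_div]
      nlinarith [sq_nonneg ϑ]
end

section
/- Let O be a matrix indexed by (Fin M → Fin d), let Ō := (1/M!) Σ_{π} U_π† O U_π (sum over all permutations π of Fin M), and let Ō̄ := ∫ (U^{⊗M})† Ō U^{⊗M} dμ(U), the Bochner integral with respect to the Haar probability measure μ on the unitary group of d×d complex matrices. Then Ō̄ commutes with U_σ for every permutation σ of Fin M, and Ō̄ commutes with V^{⊗M} for every unitary d×d matrix V. -/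
open Matrix MeasureTheory

noncomputable instance matrixMeasurableSpace {d : ℕ} :
    MeasurableSpace (Matrix (Fin d) (Fin d) ℂ) := borel _

instance matrixBorelSpace {d : ℕ} : BorelSpace (Matrix (Fin d) (Fin d) ℂ) := ⟨rfl⟩

/-- The `M`-fold tensor (Kronecker) power of a matrix, indexed by `Fin M → Fin d`:
`ρ^{⊗M}(i,j) = ∏ₖ ρ (i k) (j k)`. -/
noncomputable def tensorPow (d M : ℕ) (ρ : Matrix (Fin d) (Fin d) ℂ) :
    Matrix (Fin M → Fin d) (Fin M → Fin d) ℂ :=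
  Matrix.of fun i j => ∏ k : Fin M, ρ (i k) (j k)

/-- The permutation unitary `U_π` on `(ℂ^d)^{⊗M}`: the permutation matrix, on the index set
`Fin M → Fin d`, of the bijection `i ↦ i ∘ π`. -/
def permUnitary (d M : ℕ) (π : Equiv.Perm (Fin M)) :
    Matrix (Fin M → Fin d) (Fin M → Fin d) ℂ :=
  Matrix.of fun i j => if i = j ∘ π then 1 else 0

/-- The permutation average `Ō := (1/M!) Σ_π U_π† O U_π`. -/
noncomputable def permAvg (d M : ℕ) (O : Matrix (Fin M → Fin d) (Fin M → Fin d) ℂ) :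
    Matrix (Fin M → Fin d) (Fin M → Fin d) ℂ :=
  ((M.factorial : ℂ))⁻¹ • ∑ π : Equiv.Perm (Fin M),
    (permUnitary d M π)ᴴ * O * permUnitary d M π

/-- The unitary (Haar) average `Ō̄ := ∫ (U^{⊗M})† Ō U^{⊗M} dμ(U)`, computed entrywise. -/
noncomputable def unitaryAvg (d M : ℕ) (μ : Measure (Matrix.unitaryGroup (Fin d) ℂ))
    (O : Matrix (Fin M → Fin d) (Fin M → Fin d) ℂ) :
    Matrix (Fin M → Fin d) (Fin M → Fin d) ℂ :=
  Matrix.of fun i j =>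
    ∫ U : Matrix.unitaryGroup (Fin d) ℂ,
      ((tensorPow d M (U : Matrix (Fin d) (Fin d) ℂ))ᴴ * permAvg d M O *
        tensorPow d M (U : Matrix (Fin d) (Fin d) ℂ)) i j ∂μ

lemma MeasureTheory.Measure.isMulRightInvariant_of_compactSpace {G : Type*} [Group G]
    [TopologicalSpace G] [IsTopologicalGroup G] [CompactSpace G] [MeasurableSpace G] [BorelSpace G]
    (μ : Measure G) [IsProbabilityMeasure μ] [μ.IsMulLeftInvariant] : μ.IsMulRightInvariant where
  map_mul_right_eq_self g := by
    have isHaar (ν : Measure G) [IsProbabilityMeasure ν] [ν.IsMulLeftInvariant] :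
        ν.IsHaarMeasure :=
      Measure.isHaarMeasure_of_isCompact_nonempty_interior ν Set.univ isCompact_univ
        (by simp) (by simp) (by simp)
    have hmeas : Measurable (· * g : G → G) := measurable_mul_const g
    have : IsProbabilityMeasure (μ.map (· * g)) :=
      Measure.isProbabilityMeasure_map hmeas.aemeasurable
    have : (μ.map (· * g)).IsMulLeftInvariant := by
      refine ⟨fun h => ?_⟩
      rw [Measure.map_map (measurable_const_mul h) hmeas]
      conv_rhs => rw [← map_mul_left_eq_self μ h, Measure.map_map hmeas (measurable_const_mul h)]
      congr 1
      ext x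
      simp [mul_assoc]
    have := isHaar μ
    have := isHaar (μ.map (· * g))
    exact Measure.isHaarMeasure_eq_of_isProbabilityMeasure _ _

instance Matrix.compactSpace_unitaryGroup {n 𝕜 : Type*} [Fintype n] [DecidableEq n] [RCLike 𝕜] :
    CompactSpace (Matrix.unitaryGroup n 𝕜) := by
  refine isCompact_iff_compactSpace.mp ?_
  have hK : IsCompact (Set.univ.pi fun _ : n => Set.univ.pi fun _ : n =>
      Metric.closedBall (0 : 𝕜) 1) :=
    isCompact_univ_pi fun _ => isCompact_univ_pi fun _ => isCompact_closedBall _ _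
  refine IsCompact.of_isClosed_subset (X := Matrix n n 𝕜) hK isClosed_unitary ?_
  intro U hU i _ j _
  simpa using entry_norm_bound_of_unitary hU i j

section TensorPow

variable {d M : ℕ}

lemma tensorPow_mul (A B : Matrix (Fin d) (Fin d) ℂ) :
    tensorPow d M (A * B) = tensorPow d M A * tensorPow d M B := by
  ext i j
  simp only [tensorPow, Matrix.of_apply, Matrix.mul_apply, Finset.prod_univ_sum,
    Fintype.piFinset_univ, Finset.prod_mul_distrib]

lemma tensorPow_one : tensorPow d M 1 = 1 := by
  ext i j
  simp [tensorPow, Matrix.one_apply, Finset.prod_ite_zero, funext_iff]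

lemma tensorPow_conjTranspose (A : Matrix (Fin d) (Fin d) ℂ) :
    (tensorPow d M A)ᴴ = tensorPow d M Aᴴ := by
  ext i j
  simp [tensorPow, Matrix.conjTranspose_apply]

lemma tensorPow_mul_conjTranspose (V : Matrix.unitaryGroup (Fin d) ℂ) :
    tensorPow d M (V : Matrix (Fin d) (Fin d) ℂ) *
      (tensorPow d M (V : Matrix (Fin d) (Fin d) ℂ))ᴴ = 1 := by
  rw [tensorPow_conjTranspose, ← tensorPow_mul, ← Matrix.star_eq_conjTranspose,
    Unitary.mul_star_self_of_mem V.2, tensorPow_one]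

lemma continuous_tensorPow : Continuous (tensorPow d M) :=
  continuous_matrix fun i j => continuous_finsetProd Finset.univ fun k _ =>
    continuous_id.matrix_elem (i k) (j k)

end TensorPow

section PermUnitary

variable {d M : ℕ} (π σ : Equiv.Perm (Fin M)) (A : Matrix (Fin M → Fin d) (Fin M → Fin d) ℂ)

lemma mul_permUnitary_apply (i j : Fin M → Fin d) :
    (A * permUnitary d M σ) i j = A i (j ∘ σ) := by
  simp [permUnitary, Matrix.mul_apply]

lemma permUnitary_mul_apply (i j : Fin M → Fin d) :
    (permUnitary d M σ * A) i j = A (i ∘ σ.symm) j := by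
  simp [permUnitary, Matrix.mul_apply, ← Equiv.comp_symm_eq]

lemma permUnitary_mul : permUnitary d M π * permUnitary d M σ = permUnitary d M (σ * π) := by
  ext i j
  rw [permUnitary_mul_apply]
  simp only [permUnitary, Matrix.of_apply]
  exact if_congr (Equiv.comp_symm_eq π (j ∘ σ) i) rfl rfl

lemma permUnitary_mul_conjTranspose : permUnitary d M σ * (permUnitary d M σ)ᴴ = 1 := by
  ext i j
  rw [permUnitary_mul_apply]
  simp [permUnitary, Matrix.conjTranspose_apply, Matrix.one_apply, Function.comp_assoc,
    eq_comm]

lemma commute_permUnitary_tensorPow (B : Matrix (Fin d) (Fin d) ℂ) :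
    Commute (permUnitary d M σ) (tensorPow d M B) := by
  ext i j
  rw [permUnitary_mul_apply, mul_permUnitary_apply]
  simp only [tensorPow, Matrix.of_apply, Function.comp_apply]
  exact (Equiv.prod_comp σ _).symm.trans (by simp)

lemma conjTranspose_permUnitary_mul_permAvg_mul :
    (permUnitary d M σ)ᴴ * permAvg d M A * permUnitary d M σ = permAvg d M A := by
  simp only [permAvg, Matrix.mul_smul, Matrix.smul_mul, Finset.mul_sum, Finset.sum_mul]
  refine congr_arg _ (Fintype.sum_equiv (Equiv.mulLeft σ) _ _ fun π => ?_)
  rw [Equiv.coe_mulLeft, ← permUnitary_mul, Matrix.conjTranspose_mul]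
  simp only [Matrix.mul_assoc]

lemma commute_permUnitary_permAvg : Commute (permUnitary d M σ) (permAvg d M A) := by
  have h := congr_arg (permUnitary d M σ * ·) (conjTranspose_permUnitary_mul_permAvg_mul σ A)
  simp only [← Matrix.mul_assoc, permUnitary_mul_conjTranspose, Matrix.one_mul] at h
  exact h.symm

end PermUnitary

/-- The doubly averaged operator `Ō̄` commutes with every permutation unitary `U_σ` and with
every tensor-power unitary `V^{⊗M}`. -/
theorem unitaryAvg_commutes {d M : ℕ}
    (μ : Measure (Matrix.unitaryGroup (Fin d) ℂ))
    [IsProbabilityMeasure μ] [μ.IsMulLeftInvariant]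
    (O : Matrix (Fin M → Fin d) (Fin M → Fin d) ℂ) :
    (∀ σ : Equiv.Perm (Fin M),
        unitaryAvg d M μ O * permUnitary d M σ = permUnitary d M σ * unitaryAvg d M μ O)
      ∧ ∀ V : Matrix.unitaryGroup (Fin d) ℂ,
        unitaryAvg d M μ O * tensorPow d M (V : Matrix (Fin d) (Fin d) ℂ)
          = tensorPow d M (V : Matrix (Fin d) (Fin d) ℂ) * unitaryAvg d M μ O := by
  refine ⟨fun σ => ?_, fun V => ?_⟩
  · ext i j
    rw [mul_permUnitary_apply, permUnitary_mul_apply]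
    simp only [unitaryAvg, Matrix.of_apply]
    refine integral_congr_ae (.of_forall fun U => ?_)
    have h := congr_fun₂ (((commute_permUnitary_tensorPow σ
      (U : Matrix (Fin d) (Fin d) ℂ)ᴴ).mul_right (commute_permUnitary_permAvg σ O)).mul_right
      (commute_permUnitary_tensorPow σ (U : Matrix (Fin d) (Fin d) ℂ))).eq.symm i j
    rwa [mul_permUnitary_apply, permUnitary_mul_apply, ← tensorPow_conjTranspose] at h
  · have := μ.isMulRightInvariant_of_compactSpace
    set X : Matrix.unitaryGroup (Fin d) ℂ → Matrix (Fin M → Fin d) (Fin M → Fin d) ℂ :=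
      fun U => (tensorPow d M (U : Matrix (Fin d) (Fin d) ℂ))ᴴ * permAvg d M O *
        tensorPow d M (U : Matrix (Fin d) (Fin d) ℂ) with hX
    set T := tensorPow d M (V : Matrix (Fin d) (Fin d) ℂ) with hT
    have hcont : Continuous X := by
      have h : Continuous fun U : Matrix.unitaryGroup (Fin d) ℂ =>
          tensorPow d M (U : Matrix (Fin d) (Fin d) ℂ) :=
        continuous_tensorPow.comp continuous_subtype_val
      exact (h.matrix_conjTranspose.matrix_mul continuous_const).matrix_mul h
    have hint (i j : Fin M → Fin d) : Integrable (fun U => X U i j) μ :=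
      (hcont.matrix_elem i j).integrable_of_hasCompactSupport (.of_compactSpace _)
    have htrans (U : Matrix.unitaryGroup (Fin d) ℂ) : X U * T = T * X (U * V) := by
      simp only [hX, Submonoid.coe_mul, tensorPow_mul, Matrix.conjTranspose_mul,
        ← Matrix.mul_assoc, hT, tensorPow_mul_conjTranspose, Matrix.one_mul]
    ext i j
    calc (unitaryAvg d M μ O * T) i j = ∫ U, (X U * T) i j ∂μ := by
          simp only [Matrix.mul_apply]
          rw [integral_finsetSum _ fun k _ => (hint i k).mul_const _]
          simp only [integral_mul_const]
          rfl
      _ = ∫ U, (T * X U) i j ∂μ := by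
          simp only [htrans]
          exact integral_mul_right_eq_self (fun U => (T * X U) i j) V
      _ = (T * unitaryAvg d M μ O) i j := by
          simp only [Matrix.mul_apply]
          rw [integral_finsetSum _ fun k _ => (hint k j).const_mul _]
          simp only [integral_const_mul]
          rfl
end
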